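/- For every k ≥ 1, the determinant of the k×k matrix whose (j,m) entry is the r-Bell number B_{j,m} (for 1 ≤ j, m ≤ k) equals (∏_{i=0}^{k} i!) · (Σ_{i=0}^{k} 1/i!), the computation being carried out over the rationals. -/

import Mathlib

open scoped Classical
noncomputable section

/-- The finset of all set-partitions of `Fin m`. -/
def partitionsF (m : ℕ) : Finset (Finset (Finset (Fin m))) :=
  Finset.univ.filter fun P =>
    (∀ S ∈ P, S.Nonempty) ∧
    (∀ S ∈ P, ∀ T ∈ P, S ≠ T → Disjoint S T) ∧
    (∀ i : Fin m, ∃ S ∈ P, i ∈ S)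

/-- The `m`-th Bell number: the number of partitions of an `m`-element set. -/
def bell (m : ℕ) : ℕ := (partitionsF m).card

/-- The `r`-Bell number `B_{m,r}`: the number of partitions of a set of `m + r` elements
in which the `r` distinguished elements (the first `r` elements) lie in pairwise
distinct blocks. -/
def rBell (m r : ℕ) : ℕ :=
  ((partitionsF (m + r)).filter fun P =>
    ∀ S ∈ P, (S.filter fun i => (i : ℕ) < r).card ≤ 1).card

/-- The Stirling number of the second kind `{r, i}`: the number of partitions of an
`r`-element set into exactly `i` nonempty blocks. -/
def stirling2 (r i : ℕ) : ℕ := ((partitionsF r).filter fun P => P.card = i).card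

/-- The first `r` elements are pairwise inequivalent. -/
def GoodRel (N r : ℕ) (s : Setoid (Fin N)) : Prop :=
  ∀ i j : Fin N, i.val < r → j.val < r → s i j → i = j

/-- The partition attached to an equivalence relation. -/
def toPart {N : ℕ} (s : Setoid (Fin N)) : Finset (Finset (Fin N)) :=
  Finset.univ.image fun i => Finset.univ.filter fun j => s i j

lemma mem_toPart {N : ℕ} (s : Setoid (Fin N)) (S : Finset (Fin N)) :
    S ∈ toPart s ↔ ∃ i, (Finset.univ.filter fun j => s i j) = S := by
  simp [toPart]

lemma toPart_rel {N : ℕ} (s : Setoid (Fin N)) (i j : Fin N) :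
    s i j ↔ ∃ S ∈ toPart s, i ∈ S ∧ j ∈ S := by
  constructor
  · intro h
    refine ⟨_, (mem_toPart s _).2 ⟨i, rfl⟩, ?_, ?_⟩
    · simpa using s.refl i
    · simpa using h
  · rintro ⟨S, hS, hi, hj⟩
    obtain ⟨a, rfl⟩ := (mem_toPart s S).1 hS
    simp at hi hj
    exact s.trans (s.symm hi) hj

lemma toPart_mem {N : ℕ} (s : Setoid (Fin N)) : toPart s ∈ partitionsF N := by
  simp only [partitionsF, Finset.mem_filter, Finset.mem_univ, true_and]
  refine ⟨?_, ?_, ?_⟩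
  · intro S hS
    obtain ⟨a, rfl⟩ := (mem_toPart s S).1 hS
    exact ⟨a, by simpa using s.refl a⟩
  · intro S hS T hT hne
    obtain ⟨a, rfl⟩ := (mem_toPart s S).1 hS
    obtain ⟨b, rfl⟩ := (mem_toPart s T).1 hT
    rw [Finset.disjoint_left]
    intro x hx hx'
    apply hne
    simp at hx hx'
    ext y
    simp only [Finset.mem_filter, Finset.mem_univ, true_and]
    have hab : s a b := s.trans hx (s.symm hx')
    exact ⟨fun h => s.trans (s.symm hab) h, fun h => s.trans hab h⟩
  · intro i
    obtain ⟨S, hS, hi, _⟩ := (toPart_rel s i i).1 (s.refl i)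
    exact ⟨S, hS, hi⟩

lemma toPart_surj {N : ℕ} (P : Finset (Finset (Fin N))) (hP : P ∈ partitionsF N) :
    ∃ s : Setoid (Fin N), toPart s = P := by
  simp only [partitionsF, Finset.mem_filter, Finset.mem_univ, true_and] at hP
  obtain ⟨h1, h2, h3⟩ := hP
  have huniq : ∀ S ∈ P, ∀ T ∈ P, ∀ x, x ∈ S → x ∈ T → S = T := by
    intro S hS T hT x hxS hxT
    by_contra hne
    exact Finset.disjoint_left.1 (h2 S hS T hT hne) hxS hxT
  let s : Setoid (Fin N) :=
    { r := fun i j => ∃ S ∈ P, i ∈ S ∧ j ∈ S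
      iseqv :=
        { refl := fun i => by
            obtain ⟨S, hS, hi⟩ := h3 i
            exact ⟨S, hS, hi, hi⟩
          symm := by
            rintro i j ⟨S, hS, hi, hj⟩
            exact ⟨S, hS, hj, hi⟩
          trans := by
            rintro i j k ⟨S, hS, hi, hj⟩ ⟨T, hT, hj', hk⟩
            have := huniq S hS T hT j hj hj'
            subst this
            exact ⟨S, hS, hi, hk⟩ } }
  have key : ∀ S ∈ P, ∀ a ∈ S, (Finset.univ.filter fun j => s a j) = S := by
    intro S hS a ha
    ext y
    simp only [Finset.mem_filter, Finset.mem_univ, true_and]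
    constructor
    · rintro ⟨T, hT, haT, hyT⟩
      rw [huniq S hS T hT a ha haT]
      exact hyT
    · intro hy
      exact ⟨S, hS, ha, hy⟩
  refine ⟨s, ?_⟩
  ext S
  rw [mem_toPart]
  constructor
  · rintro ⟨a, rfl⟩
    obtain ⟨S, hS, ha⟩ := h3 a
    rw [key S hS a ha]
    exact hS
  · intro hS
    obtain ⟨a, ha⟩ := h1 S hS
    exact ⟨a, key S hS a ha⟩

lemma good_iff {N r : ℕ} (s : Setoid (Fin N)) :
    GoodRel N r s ↔ ∀ S ∈ toPart s, (S.filter fun i => (i : ℕ) < r).card ≤ 1 := by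
  constructor
  · intro h S hS
    rw [Finset.card_le_one]
    intro a ha b hb
    simp at ha hb
    obtain ⟨⟨a', ha', rfl⟩, har⟩ := ha
    obtain ⟨⟨b', hb', rfl⟩, hbr⟩ := hb
    exact congrArg Fin.val (h a' b' har hbr ((toPart_rel s a' b').2 ⟨S, hS, ha', hb'⟩))
  · intro h i j hi hj hij
    obtain ⟨S, hS, hiS, hjS⟩ := (toPart_rel s i j).1 hij
    have := h S hS
    rw [Finset.card_le_one] at this
    exact Fin.ext (this i.val (by simp only [Finset.mem_filter]; simp; exact ⟨⟨i, hiS, rfl⟩, hi⟩)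
      j.val (by simp only [Finset.mem_filter]; simp; exact ⟨⟨j, hjS, rfl⟩, hj⟩))

lemma rBell_eq_card (m r : ℕ) :
    rBell m r = Nat.card {s : Setoid (Fin (m + r)) // GoodRel (m + r) r s} := by
  unfold rBell
  rw [← Fintype.card_coe, ← Nat.card_eq_fintype_card]
  symm
  refine Nat.card_eq_of_bijective
    (fun s => ⟨toPart s.1, Finset.mem_filter.2 ⟨toPart_mem s.1, (good_iff s.1).1 s.2⟩⟩) ⟨?_, ?_⟩
  · rintro ⟨s, hs⟩ ⟨t, ht⟩ h
    have h' : toPart s = toPart t := congrArg Subtype.val h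
    apply Subtype.ext
    apply Setoid.ext
    intro a b
    change s a b ↔ t a b
    rw [toPart_rel, toPart_rel, h']
  · rintro ⟨P, hP⟩
    rw [Finset.mem_filter] at hP
    obtain ⟨s, rfl⟩ := toPart_surj P hP.1
    exact ⟨⟨s, (good_iff s).2 hP.2⟩, rfl⟩

lemma setoid_fin_finite (N : ℕ) : Finite (Setoid (Fin N)) := by
  refine Finite.of_injective (toPart (N := N)) ?_
  intro s t h
  apply Setoid.ext
  intro a b
  change s a b ↔ t a b
  rw [toPart_rel, toPart_rel, h]

lemma rBell_zero (r : ℕ) : rBell 0 r = 1 := by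
  rw [rBell_eq_card, Nat.card_eq_one_iff_unique]
  refine ⟨⟨?_⟩, ⟨⊥, fun i j _ _ h => h⟩⟩
  rintro ⟨s, hs⟩ ⟨t, ht⟩
  apply Subtype.ext
  apply Setoid.ext
  intro a b
  change s a b ↔ t a b
  constructor
  · intro h
    rw [hs a b (by omega) (by omega) h]
  · intro h
    rw [ht a b (by omega) (by omega) h]

/-- Collapse element `x` onto `i`. -/
def collapse {M : ℕ} (x : Fin (M + 1)) (i : Fin M) (y : Fin (M + 1)) : Fin M :=
  if h : ∃ z, x.succAbove z = y then h.choose else i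

lemma collapse_succAbove {M : ℕ} (x : Fin (M + 1)) (i z : Fin M) :
    collapse x i (x.succAbove z) = z := by
  have h : ∃ w, x.succAbove w = x.succAbove z := ⟨z, rfl⟩
  rw [collapse, dif_pos h]
  exact Fin.succAbove_right_injective h.choose_spec

lemma collapse_self {M : ℕ} (x : Fin (M + 1)) (i : Fin M) : collapse x i x = i := by
  rw [collapse, dif_neg]
  rintro ⟨z, hz⟩
  exact Fin.succAbove_ne x z hz

lemma succAbove_low {M r : ℕ} (x : Fin (M + 1)) (hx : x.val = r) (z : Fin M) (hz : z.val < r) :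
    (x.succAbove z).val = z.val := by
  rw [Fin.succAbove_of_castSucc_lt]
  · rfl
  · rw [Fin.lt_def]; simp; omega

lemma low_exists {M r : ℕ} (x : Fin (M + 1)) (hx : x.val = r) (y : Fin (M + 1)) (hy : y.val < r) :
    ∃ z : Fin M, z.val < r ∧ x.succAbove z = y := by
  have hlt : y.val < M := by omega
  refine ⟨⟨y.val, hlt⟩, hy, ?_⟩
  apply Fin.ext
  rw [succAbove_low x hx _ (by simpa using hy)]

lemma card_rec (M r : ℕ) (hr : r ≤ M) :
    Nat.card {s : Setoid (Fin (M + 1)) // GoodRel (M + 1) r s} =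
      r * Nat.card {s : Setoid (Fin M) // GoodRel M r s} +
      Nat.card {s : Setoid (Fin (M + 1)) // GoodRel (M + 1) (r + 1) s} := by
  have := setoid_fin_finite M
  have := setoid_fin_finite (M + 1)
  let x : Fin (M + 1) := ⟨r, by omega⟩
  have hx : x.val = r := rfl
  have hr' : Nat.card (Fin r) = r := by simp
  conv_rhs => rw [← hr']
  rw [hr', ← Nat.card_fin r, Nat.card_fin r]
  conv_rhs => enter [1, 1]; rw [← Nat.card_fin r]
  rw [← Nat.card_prod, ← Nat.card_sum]
  symm
  let emb : Fin r → Fin M := fun i => ⟨i.val, by omega⟩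
  have hgood : ∀ (i : Fin r) (s : Setoid (Fin M)), GoodRel M r s →
      GoodRel (M + 1) r (s.comap (collapse x (emb i))) := by
    intro i s hs a b ha hb hab
    obtain ⟨a', ha', rfl⟩ := low_exists x hx a ha
    obtain ⟨b', hb', rfl⟩ := low_exists x hx b hb
    rw [Setoid.comap_rel, collapse_succAbove, collapse_succAbove] at hab
    rw [hs a' b' ha' hb' hab]
  have hrel : ∀ (i : Fin r) (s : Setoid (Fin M)),
      (s.comap (collapse x (emb i))) x (x.succAbove (emb i)) := by
    intro i s
    rw [Setoid.comap_rel, collapse_self, collapse_succAbove]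
  have hxlow : ∀ i : Fin r, (x.succAbove (emb i)).val < r := by
    intro i
    rw [succAbove_low x hx _ i.2]
    exact i.2
  refine Nat.card_eq_of_bijective
    (Sum.elim (fun p => ⟨p.2.1.comap (collapse x (emb p.1)), hgood p.1 p.2.1 p.2.2⟩)
      (fun s => ⟨s.1, fun a b ha hb h => s.2 a b (by omega) (by omega) h⟩)) ⟨?_, ?_⟩
  · have hcross : ∀ (i : Fin r) (s : Setoid (Fin M)) (t : Setoid (Fin (M + 1))),
        GoodRel (M + 1) (r + 1) t → s.comap (collapse x (emb i)) = t → False := by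
      intro i s t ht h
      have h1 := hrel i s
      rw [h] at h1
      have h2 := ht _ _ (by omega) (by have := hxlow i; omega) h1
      exact Fin.succAbove_ne x _ h2.symm
    rintro (⟨i, s, hs⟩ | ⟨s, hs⟩) (⟨j, t, ht⟩ | ⟨t, ht⟩) h
    · have h' : s.comap (collapse x (emb i)) = t.comap (collapse x (emb j)) :=
        congrArg Subtype.val h
      have hst : s = t := by
        apply Setoid.ext
        intro a b
        have h2 : (s.comap (collapse x (emb i))) (x.succAbove a) (x.succAbove b) ↔
            (t.comap (collapse x (emb j))) (x.succAbove a) (x.succAbove b) := by rw [h']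
        simpa only [Setoid.comap_rel, collapse_succAbove] using h2
      subst hst
      have h1 := hrel i s
      rw [h', Setoid.comap_rel, collapse_self, collapse_succAbove] at h1
      have h3 := hs _ _ j.2 i.2 h1
      have h4 : i = j := by
        apply Fin.ext
        exact (congrArg Fin.val h3).symm
      subst h4
      rfl
    · exact (hcross i s t ht (congrArg Subtype.val h)).elim
    · exact (hcross j t s hs (congrArg Subtype.val h).symm).elim
    · have h' : s = t := congrArg Subtype.val h
      subst h'
      rfl
  · rintro ⟨t, ht⟩
    by_cases hex : ∃ y : Fin (M + 1), y.val < r ∧ t x y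
    · obtain ⟨y, hy, hxy⟩ := hex
      obtain ⟨z, hz, rfl⟩ := low_exists x hx y hy
      have hs : GoodRel M r (t.comap x.succAbove) := by
        intro a b ha hb hab
        rw [Setoid.comap_rel] at hab
        have := ht _ _ (by rw [succAbove_low x hx a ha]; exact ha)
          (by rw [succAbove_low x hx b hb]; exact hb) hab
        exact Fin.succAbove_right_injective this
      refine ⟨Sum.inl (⟨z.val, hz⟩, ⟨t.comap x.succAbove, hs⟩), ?_⟩
      apply Subtype.ext
      change (t.comap x.succAbove).comap (collapse x z) = t
      have hfix : ∀ a, t (x.succAbove (collapse x z a)) a := by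
        intro a
        by_cases hax : a = x
        · rw [hax, collapse_self]
          exact t.symm hxy
        · obtain ⟨w, rfl⟩ := Fin.exists_succAbove_eq hax
          rw [collapse_succAbove]
      apply Setoid.ext
      intro a b
      rw [Setoid.comap_rel, Setoid.comap_rel]
      exact ⟨fun h => t.trans (t.symm (hfix a)) (t.trans h (hfix b)),
        fun h => t.trans (hfix a) (t.trans h (t.symm (hfix b)))⟩
    · refine ⟨Sum.inr ⟨t, ?_⟩, rfl⟩
      intro a b ha hb hab
      by_cases hax : a = x
      · by_cases hbx : b = x
        · rw [hax, hbx]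
        · exfalso
          subst hax
          exact hex ⟨b, by have : b.val ≠ x.val := fun h => hbx (Fin.ext h)
                           omega, hab⟩
      · have ha' : a.val < r := by
          have : a.val ≠ x.val := fun h => hax (Fin.ext h)
          omega
        by_cases hbx : b = x
        · exfalso
          subst hbx
          exact hex ⟨a, ha', t.symm hab⟩
        · have : b.val ≠ x.val := fun h => hbx (Fin.ext h)
          exact ht a b ha' (by omega) hab

lemma rBell_succ (n r : ℕ) : rBell (n + 1) r = r * rBell n r + rBell n (r + 1) := by
  have h := card_rec (n + r) r (by omega)
  rw [rBell_eq_card, rBell_eq_card, rBell_eq_card]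
  have e : n + 1 + r = n + r + 1 := by omega
  rw [e]
  exact h

/-- `n! * ∑_{i ≤ n} 1/i!`. -/
def eSeq : ℕ → ℚ
  | 0 => 1
  | n + 1 => (n + 1) * eSeq n + 1

lemma eSeq_pos (n : ℕ) : 0 < eSeq n := by
  induction n with
  | zero => simp [eSeq]
  | succ n ih => rw [eSeq]; positivity

lemma eSeq_eq (n : ℕ) :
    eSeq n = (n.factorial : ℚ) * ∑ i ∈ Finset.range (n + 1), 1 / (i.factorial : ℚ) := by
  induction n with
  | zero => simp [eSeq]
  | succ n ih =>
    rw [eSeq, ih, Finset.sum_range_succ _ (n + 1), Nat.factorial_succ]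
    have : (n.factorial : ℚ) ≠ 0 := by positivity
    push_cast
    field_simp

/-- `(x-1)(x-2)⋯(x-i)`. -/
def hPoly (i : ℕ) (m : ℕ) : ℚ := ∏ l ∈ Finset.range i, ((m : ℚ) - 1 - l)

lemma hPoly_succ (i m : ℕ) : hPoly (i + 1) m = hPoly i m * ((m : ℚ) - 1 - i) := by
  simp [hPoly, Finset.prod_range_succ]

lemma hPoly_shift (i m : ℕ) : hPoly (i + 1) (m + 1) = m * hPoly i m := by
  simp only [hPoly]
  rw [Finset.prod_range_succ']
  push_cast
  rw [mul_comm]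
  congr 1
  · ring
  · apply Finset.prod_congr rfl
    intros; ring

/-- The triangular basis. -/
def gPoly (i : ℕ) (m : ℕ) : ℚ := hPoly (i + 1) m + eSeq (i + 1) / eSeq i * hPoly i m

/-- The operator `f ↦ x f(x) + f(x+1)`. -/
def opT : (ℕ → ℚ) →ₗ[ℚ] (ℕ → ℚ) where
  toFun f := fun m => m * f m + f (m + 1)
  map_add' f g := by funext m; simp; ring
  map_smul' c f := by funext m; simp; ring

lemma opT_h_zero : opT (hPoly 0) = gPoly 0 := by
  funext m
  simp [opT, gPoly, hPoly, eSeq]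

lemma opT_h_succ (i : ℕ) :
    opT (hPoly (i + 1)) = gPoly (i + 1) + ((i + 1) * eSeq i / eSeq (i + 1)) • gPoly i := by
  funext m
  have h0 := (eSeq_pos i).ne'
  have h1 := (eSeq_pos (i + 1)).ne'
  have h2 : eSeq (i + 2) = (i + 3) * eSeq (i + 1) - (i + 1) * eSeq i := by
    simp only [eSeq]; push_cast; ring
  simp only [opT, LinearMap.coe_mk, AddHom.coe_mk, Pi.add_apply, Pi.smul_apply, smul_eq_mul,
    gPoly, hPoly_shift]
  rw [show i + 1 + 1 = i + 2 from rfl, h2, hPoly_succ (i + 1), hPoly_succ i]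
  field_simp
  push_cast
  ring

/-- Span of the first `n` basis functions. -/
def gSpan (n : ℕ) : Submodule ℚ (ℕ → ℚ) := Submodule.span ℚ (Set.image gPoly (Finset.range n : Set ℕ))

lemma g_mem {i n : ℕ} (h : i < n) : gPoly i ∈ gSpan n :=
  Submodule.subset_span ⟨i, by simpa using h, rfl⟩

lemma opT_g (i : ℕ) : opT (gPoly i) - gPoly (i + 1) ∈ gSpan (i + 1) := by
  have e : gPoly i = hPoly (i + 1) + (eSeq (i + 1) / eSeq i) • hPoly i := by
    funext m; simp [gPoly]
  rw [e, map_add, map_smul, opT_h_succ]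
  rw [add_assoc, add_sub_cancel_left]
  refine Submodule.add_mem _ (Submodule.smul_mem _ _ (g_mem (by omega)))
    (Submodule.smul_mem _ _ ?_)
  cases i with
  | zero => rw [opT_h_zero]; exact g_mem (by omega)
  | succ i =>
    rw [opT_h_succ]
    exact Submodule.add_mem _ (g_mem (by omega)) (Submodule.smul_mem _ _ (g_mem (by omega)))

lemma gSpan_mono {a b : ℕ} (h : a ≤ b) : gSpan a ≤ gSpan b := by
  apply Submodule.span_mono
  apply Set.image_mono
  intro x hx
  simp at hx ⊢
  omega

lemma opT_span (n : ℕ) (f : ℕ → ℚ) (hf : f ∈ gSpan n) : opT f ∈ gSpan (n + 1) := by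
  have : gSpan n ≤ (gSpan (n + 1)).comap opT := by
    unfold gSpan
    rw [Submodule.span_le]
    rintro _ ⟨i, hi, rfl⟩
    have hi' : i < n := by simpa using hi
    change opT (gPoly i) ∈ gSpan (n + 1)
    have h := Submodule.add_mem _ (gSpan_mono (show i + 1 ≤ n + 1 by omega) (opT_g i))
      (g_mem (show i + 1 < n + 1 by omega))
    simpa using h
  exact this hf

lemma rBell_opT (n : ℕ) :
    (fun m => (rBell (n + 1) m : ℚ)) = opT (fun m => (rBell n m : ℚ)) := by
  funext m
  simp [opT, rBell_succ]

lemma rBell_sub_mem (j : ℕ) :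
    (fun m => (rBell (j + 1) m : ℚ)) - gPoly j ∈ gSpan j := by
  induction j with
  | zero =>
    have : (fun m => (rBell 0 m : ℚ)) = hPoly 0 := by
      funext m; simp [rBell_zero, hPoly]
    rw [rBell_opT, this, opT_h_zero, sub_self]
    exact Submodule.zero_mem _
  | succ j ih =>
    rw [rBell_opT]
    have h := Submodule.add_mem _ (opT_span _ _ ih) (opT_g j)
    rw [map_sub] at h
    simpa using h

lemma rBell_expand (j : ℕ) : ∃ c : ℕ → ℚ, c j = 1 ∧ (∀ i, j < i → c i = 0) ∧
    ∀ m, (rBell (j + 1) m : ℚ) = ∑ i ∈ Finset.range (j + 1), c i * gPoly i m := by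
  have h := rBell_sub_mem j
  unfold gSpan at h
  rw [Submodule.mem_span_image_finset_iff_exists_fun] at h
  obtain ⟨c', hc⟩ := h
  obtain ⟨c, hcc⟩ : ∃ c : ℕ → ℚ, ∀ i : Finset.range j, c' i = c i.1 :=
    ⟨fun i => if hi : i ∈ Finset.range j then c' ⟨i, hi⟩ else 0, fun i => by simp [i.2]⟩
  simp only [hcc] at hc
  rw [Finset.sum_coe_sort (Finset.range j) (fun i => c i • gPoly i)] at hc
  refine ⟨fun i => if i < j then c i else if i = j then 1 else 0, by simp, ?_, ?_⟩
  · intro i hi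
    simp [show ¬ i < j by omega, show i ≠ j by omega]
  · intro m
    have h2 := congrFun hc m
    simp only [Finset.sum_apply, Pi.smul_apply, smul_eq_mul, Pi.sub_apply] at h2
    rw [Finset.sum_range_succ]
    have h3 : ∑ i ∈ Finset.range j, (if i < j then c i else if i = j then 1 else 0) * gPoly i m
        = ∑ i ∈ Finset.range j, c i * gPoly i m := by
      apply Finset.sum_congr rfl
      intro i hi
      rw [if_pos (by simpa using hi)]
    rw [h3, h2]
    simp

lemma hPoly_vanish (i m : ℕ) (h : m < i) : hPoly i (m + 1) = 0 := by
  apply Finset.prod_eq_zero (i := m) (by simpa using h)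
  push_cast; ring

lemma hPoly_diag (i : ℕ) : hPoly i (i + 1) = (i.factorial : ℚ) := by
  induction i with
  | zero => simp [hPoly]
  | succ i ih => rw [hPoly_shift, ih, Nat.factorial_succ]; push_cast; ring

lemma gPoly_vanish (i m : ℕ) (h : m < i) : gPoly i (m + 1) = 0 := by
  simp [gPoly, hPoly_vanish i m h, hPoly_vanish (i + 1) m (by omega)]

lemma gPoly_diag (i : ℕ) : gPoly i (i + 1) = eSeq (i + 1) / eSeq i * (i.factorial : ℚ) := by
  simp [gPoly, hPoly_diag, hPoly_vanish (i + 1) i (by omega)]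

lemma prod_gPoly (k : ℕ) : ∏ i ∈ Finset.range k, gPoly i (i + 1) =
    eSeq k * ∏ i ∈ Finset.range k, (i.factorial : ℚ) := by
  induction k with
  | zero => simp [eSeq]
  | succ k ih =>
    rw [Finset.prod_range_succ, ih, Finset.prod_range_succ, gPoly_diag]
    have := (eSeq_pos k).ne'
    field_simp

/-- The determinant of the `k×k` matrix `(B_{j,m})_{1 ≤ j,m ≤ k}` of `r`-Bell numbers
equals `(∏_{i=0}^{k} i!) · (Σ_{i=0}^{k} 1/i!)`, over the rationals. -/
theorem det_rBell_matrix (k : ℕ) (hk : 1 ≤ k) :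
    (Matrix.of fun j m : Fin k => (rBell (j.val + 1) (m.val + 1) : ℚ)).det
      = (∏ i ∈ Finset.range (k + 1), (Nat.factorial i : ℚ)) *
        (∑ i ∈ Finset.range (k + 1), 1 / (Nat.factorial i : ℚ)) := by
  choose c hc1 hc0 hc using rBell_expand
  have hfac : (Matrix.of fun j m : Fin k => (rBell (j.val + 1) (m.val + 1) : ℚ)) =
      (Matrix.of fun j i : Fin k => c j.val i.val) *
      (Matrix.of fun i m : Fin k => gPoly i.val (m.val + 1)) := by
    ext j m
    rw [Matrix.mul_apply]
    simp only [Matrix.of_apply]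
    rw [hc, Fin.sum_univ_eq_sum_range (fun i => c j.val i * gPoly i (m.val + 1)) k]
    apply Finset.sum_subset
    · intro i hi
      simp at hi ⊢
      omega
    · intro i _ hi
      simp at hi
      rw [hc0 _ _ (by omega), zero_mul]
  rw [hfac, Matrix.det_mul, Matrix.det_of_isLowerTriangular, Matrix.det_of_isUpperTriangular]
  · simp only [Matrix.of_apply, hc1, Finset.prod_const_one, one_mul]
    rw [Fin.prod_univ_eq_prod_range (fun i => gPoly i (i + 1)) k, prod_gPoly, eSeq_eq,
      Finset.prod_range_succ _ k]
    ring
  · intro i j hij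
    exact gPoly_vanish _ _ hij
  · intro i j hij
    exact hc0 _ _ hij
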